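/- Let n ≥ 2, let m be an integer with 2 ≤ m ≤ n, and let ē, f ∈ ℝ. Then ε(n,m,ē,f) = f · ε(n−2, m−2, ē) + 2(ē − f) · ε(n−2, m−1, ē) + (1 − 2ē + f) · ε(n−2, m, ē), where ε(N,m,ē) = Σ_{k=m}^{N} C(N,k) ē^k (1−ē)^{N−k} is the binomial tail probability. -/

import Mathlib

/-- The joint factor for the correlated pair of classifiers `n-1` and `n`
(identically distributed case, common error rate `eb`). -/
noncomputable def gpair (n : ℕ) (eb f : ℝ) (A : Finset ℕ) : ℝ :=
  if n - 1 ∈ A ∧ n ∈ A then f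
  else if n - 1 ∈ A ∨ n ∈ A then eb - f
  else 1 - 2 * eb + f

/-- Correlated-pair probability (identically distributed case) that exactly
`k` of the `n` classifiers err, where the pair `(n-1, n)` has joint error
probability `f`. -/
noncomputable def pCorI (n : ℕ) (eb f : ℝ) (k : ℕ) : ℝ :=
  ∑ A ∈ (Finset.Icc 1 n).powerset.filter (fun A => A.card = k),
    eb ^ (A ∩ Finset.Icc 1 (n - 2)).card *
      (1 - eb) ^ ((n - 2) - (A ∩ Finset.Icc 1 (n - 2)).card) * gpair n eb f A

/-- Correlated-pair tail probability: at least `m` errors out of `n`. -/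
noncomputable def epsCor (n m : ℕ) (eb f : ℝ) : ℝ :=
  ∑ k ∈ Finset.Icc m n, pCorI n eb f k

/-- Binomial probability `C(N,k) ē^k (1-ē)^(N-k)`. -/
noncomputable def pBin (N k : ℕ) (eb : ℝ) : ℝ :=
  (N.choose k : ℝ) * eb ^ k * (1 - eb) ^ (N - k)

/-- Binomial tail probability: at least `m` errors out of `N`. -/
noncomputable def epsBin (N m : ℕ) (eb : ℝ) : ℝ :=
  ∑ k ∈ Finset.Icc m N, pBin N k eb

lemma epsBin_eq_sum_powerset (s : Finset ℕ) (m : ℕ) (eb : ℝ) :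
    epsBin s.card m eb =
      ∑ A ∈ s.powerset, if m ≤ A.card then eb ^ A.card * (1 - eb) ^ (s.card - A.card) else 0 := by
  rw [Finset.sum_powerset_apply_card
    (fun k => if m ≤ k then eb ^ k * (1 - eb) ^ (s.card - k) else 0)]
  have h : Finset.Icc m s.card = (Finset.range (s.card + 1)).filter (fun k => m ≤ k) := by
    ext k
    simp only [Finset.mem_Icc, Finset.mem_filter, Finset.mem_range]
    omega
  rw [epsBin, h, Finset.sum_filter]
  refine Finset.sum_congr rfl fun k _ => ?_
  split_ifs
  · simp [pBin, mul_assoc]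
  · simp

lemma epsCor_eq_sum_powerset (n m : ℕ) (eb f : ℝ) :
    epsCor n m eb f =
      ∑ A ∈ (Finset.Icc 1 n).powerset, if m ≤ A.card then
        eb ^ (A ∩ Finset.Icc 1 (n - 2)).card *
          (1 - eb) ^ ((n - 2) - (A ∩ Finset.Icc 1 (n - 2)).card) * gpair n eb f A else 0 := by
  simp only [epsCor, pCorI, Finset.sum_filter]
  rw [Finset.sum_comm]
  refine Finset.sum_congr rfl fun A hA => ?_
  have hcard : A.card ≤ n := by
    simpa using Finset.card_le_card (Finset.mem_powerset.mp hA)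
  rw [Finset.sum_ite_eq]
  simp [hcard]

theorem stmt12 (n m : ℕ) (hn : 2 ≤ n) (hm2 : 2 ≤ m) (hmn : m ≤ n) (eb f : ℝ) :
    epsCor n m eb f =
      f * epsBin (n - 2) (m - 2) eb + 2 * (eb - f) * epsBin (n - 2) (m - 1) eb
        + (1 - 2 * eb + f) * epsBin (n - 2) m eb := by
  obtain ⟨N, rfl⟩ := Nat.exists_eq_add_of_le' hn
  obtain ⟨M, rfl⟩ := Nat.exists_eq_add_of_le' hm2
  have hIcc : Finset.Icc 1 (N + 2) = insert (N + 2) (insert (N + 1) (Finset.Icc 1 N)) := by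
    ext k
    simp only [Finset.mem_Icc, Finset.mem_insert]
    omega
  have hbin (j : ℕ) : epsBin N j eb = ∑ A ∈ (Finset.Icc 1 N).powerset,
      if j ≤ A.card then eb ^ A.card * (1 - eb) ^ (N - A.card) else 0 := by
    simpa using epsBin_eq_sum_powerset (Finset.Icc 1 N) j eb
  rw [epsCor_eq_sum_powerset, hIcc, Finset.sum_powerset_insert (by simp),
    Finset.sum_powerset_insert (by simp), Finset.sum_powerset_insert (by simp)]
  simp only [Nat.add_sub_cancel, show M + 2 - 1 = M + 1 by omega, hbin, Finset.mul_sum,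
    ← Finset.sum_add_distrib]
  refine Finset.sum_congr rfl fun A hA => ?_
  have hsub : A ⊆ Finset.Icc 1 N := Finset.mem_powerset.mp hA
  have h1 : N + 1 ∉ A := fun h => by simpa using hsub h
  have h2 : N + 2 ∉ A := fun h => by simpa using hsub h
  have h21 : N + 2 ∉ insert (N + 1) A := by simp [h2]
  have hinter : A ∩ Finset.Icc 1 N = A := Finset.inter_eq_left.mpr hsub
  have e1 : insert (N + 1) A ∩ Finset.Icc 1 N = A := by
    rw [Finset.insert_inter_of_notMem (by simp), hinter]
  have e2 : insert (N + 2) A ∩ Finset.Icc 1 N = A := by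
    rw [Finset.insert_inter_of_notMem (by simp), hinter]
  have e3 : insert (N + 2) (insert (N + 1) A) ∩ Finset.Icc 1 N = A := by
    rw [Finset.insert_inter_of_notMem (by simp), e1]
  have g0 : gpair (N + 2) eb f A = 1 - 2 * eb + f := by simp [gpair, h1, h2]
  have g1 : gpair (N + 2) eb f (insert (N + 1) A) = eb - f := by simp [gpair, h2]
  have g2 : gpair (N + 2) eb f (insert (N + 2) A) = eb - f := by simp [gpair, h1]
  have g3 : gpair (N + 2) eb f (insert (N + 2) (insert (N + 1) A)) = f := by simp [gpair]
  rw [hinter, e1, e2, e3, g0, g1, g2, g3, Finset.card_insert_of_notMem h21,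
    Finset.card_insert_of_notMem h1, Finset.card_insert_of_notMem h2]
  simp only [show M + 2 ≤ A.card + 1 ↔ M + 1 ≤ A.card by omega,
    show M + 2 ≤ A.card + 1 + 1 ↔ M ≤ A.card by omega]
  split_ifs <;> ring
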